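/- Let (T,d) be a compact metric space and m a Borel probability measure on T. Let φ and ψ be Young functions with φ(1)=ψ(1)=1, and suppose there exist R>1 and an integer n₀≥1 such that (i) φ(R^k)/φ(R^{k+1}) ≤ φ(R^{k-1})/φ(R^k) for all integers k≥1, and (ii) Σ_{k=0}^{∞} φ(R^k)/ψ(R^{k+n₀}) < ∞. Set ψ₊(x) := max(ψ(x)−1, 0). Then there exist a Borel probability measure ν on T×T and a constant K ∈ (0,∞) depending only on φ, ψ, R, n₀ such that for every continuous function f : T → ℝ and all s,t ∈ T: |f(s)−f(t)| ≤ K · |f^d|^ν_{ψ₊} · τ_{m,φ}(s,t). -/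

import Mathlib

open MeasureTheory ENNReal Filter

noncomputable section

/-- A (finite) Young function: an increasing convex function `φ : [0,∞) → [0,∞)`
with `φ 0 = 0` and `φ x → ∞` as `x → ∞`. -/
def IsYoungFunction (φ : ℝ → ℝ) : Prop :=
  MonotoneOn φ (Set.Ici 0) ∧ ConvexOn ℝ (Set.Ici 0) φ ∧ φ 0 = 0 ∧
    Tendsto φ atTop atTop

/-- Generalized inverse of a Young function, as a map `ℝ≥0∞ → ℝ≥0∞`
(so that in particular `φ⁻¹(∞) = ∞`). -/
def yinv (φ : ℝ → ℝ) (y : ℝ≥0∞) : ℝ≥0∞ :=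
  sInf {x : ℝ≥0∞ | ∃ r : ℝ, 0 ≤ r ∧ x = ENNReal.ofReal r ∧ y ≤ ENNReal.ofReal (φ r)}

/-- The minorizing metric
`τ_{m,φ}(s,t) = max_{x ∈ {s,t}} ∫_0^{d(s,t)} φ⁻¹(1 / m(B(x,ε))) dε`,
with the conventions `1/0 = ∞`, `φ⁻¹(∞) = ∞`. -/
def tauDist {T : Type*} [MetricSpace T] [MeasurableSpace T]
    (m : Measure T) (φ : ℝ → ℝ) (s t : T) : ℝ≥0∞ :=
  max (∫⁻ ε in Set.Ioc (0 : ℝ) (dist s t), yinv φ (1 / m (Metric.closedBall s ε)))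
    (∫⁻ ε in Set.Ioc (0 : ℝ) (dist s t), yinv φ (1 / m (Metric.closedBall t ε)))

/-- `f^d(u,v) = |f(u) - f(v)| / d(u,v)`, equal to `0` on the diagonal. -/
def fdiv {T : Type*} [MetricSpace T] (f : T → ℝ) (p : T × T) : ℝ :=
  |f p.1 - f p.2| / dist p.1 p.2

/-- The Luxemburg norm `|g|^ν_χ = inf {a > 0 : ∫ χ(|g|/a) dν ≤ 1}`, with value `∞`
if no such `a` exists. -/
def luxNorm {X : Type*} [MeasurableSpace X] (ν : Measure X) (χ : ℝ → ℝ)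
    (g : X → ℝ) : ℝ≥0∞ :=
  sInf {a : ℝ≥0∞ | ∃ b : ℝ, 0 < b ∧ a = ENNReal.ofReal b ∧
    ∫⁻ u, ENNReal.ofReal (χ (|g u| / b)) ∂ν ≤ 1}

/-- The Amemiya norm `‖g‖^μ_χ = inf_{a>0} a (1 + ∫ χ(|g|/a) dμ)`. -/
def amemiyaNorm {X : Type*} [MeasurableSpace X] (μ : Measure X) (χ : ℝ → ℝ)
    (g : X → ℝ) : ℝ≥0∞ :=
  sInf {c : ℝ≥0∞ | ∃ a : ℝ, 0 < a ∧
    c = ENNReal.ofReal a * (1 + ∫⁻ u, ENNReal.ofReal (χ (|g u| / a)) ∂μ)}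

/-- `r_0(x) = D(T)` and, for `k ≥ 1`,
`r_k(x) = min {ε ≥ 0 : 1 / m(B(x,ε)) ≤ φ(R^k)}` (with `1/0 = ∞`). -/
def rad {T : Type*} [MetricSpace T] [MeasurableSpace T]
    (m : Measure T) (φ : ℝ → ℝ) (R : ℝ) : ℕ → T → ℝ
  | 0, _ => Metric.diam (Set.univ : Set T)
  | k + 1, x => sInf {ε : ℝ | 0 ≤ ε ∧
      1 / m (Metric.closedBall x ε) ≤ ENNReal.ofReal (φ (R ^ (k + 1)))}

/-- `r^l_k(x) = ∑_{i=k}^{l} 2^(i-k) r_i(x)`. -/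
def radl {T : Type*} [MetricSpace T] [MeasurableSpace T]
    (m : Measure T) (φ : ℝ → ℝ) (R : ℝ) (k l : ℕ) (x : T) : ℝ :=
  ∑ i ∈ Finset.Icc k l, (2 : ℝ) ^ (i - k) * rad m φ R i x

/-- The averaging operator `S_k f (x) = (1 / m(B_k(x))) ∫_{B_k(x)} f dm`,
with the convention `0/0 = 0`. -/
def avg {T : Type*} [MetricSpace T] [MeasurableSpace T]
    (m : Measure T) (φ : ℝ → ℝ) (R : ℝ) (k : ℕ) (f : T → ℝ) (x : T) : ℝ :=
  (∫ u in Metric.closedBall x (rad m φ R k x), f u ∂m) /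
    (m (Metric.closedBall x (rad m φ R k x))).toReal

/-- The iterated averaging operator `iterAvg k l f = S_l S_{l-1} ⋯ S_k f` (for `k ≤ l`). -/
def iterAvg {T : Type*} [MetricSpace T] [MeasurableSpace T]
    (m : Measure T) (φ : ℝ → ℝ) (R : ℝ) (k : ℕ) : ℕ → (T → ℝ) → T → ℝ
  | 0, f => avg m φ R 0 f
  | l + 1, f =>
      if l + 1 ≤ k then avg m φ R (l + 1) f
      else avg m φ R (l + 1) (iterAvg m φ R k l f)

/-- The set `{k ≥ 1 : B^l_k(s) ∪ B^l_k(t) ⊆ B°(u, r_{k-1}(u)) for every u ∈ B^l_k(x)}`,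
whose greatest element is `τ_x`. -/
def tauSet {T : Type*} [MetricSpace T] [MeasurableSpace T]
    (m : Measure T) (φ : ℝ → ℝ) (R : ℝ) (l : ℕ) (s t x : T) : Set ℕ :=
  {k : ℕ | 1 ≤ k ∧ ∀ u ∈ Metric.closedBall x (radl m φ R k l x),
    Metric.closedBall s (radl m φ R k l s) ∪ Metric.closedBall t (radl m φ R k l t) ⊆
      Metric.ball u (rad m φ R (k - 1) u)}

/-- The exponentially weighted tail sum `∑_{i=k}^{l} 2^(i-k) r_i`, which bounds the distance
travelled by a chain descending from level `l` to level `k`. -/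
def chainRadius (r : ℕ → ℝ) (l k : ℕ) : ℝ :=
  ∑ i ∈ Finset.Ico k (l + 1), (2 : ℝ) ^ (i - k) * r i

theorem chainRadius_succ_self (r : ℕ → ℝ) (l : ℕ) : chainRadius r l (l + 1) = 0 := by
  simp [chainRadius]

theorem chainRadius_eq (r : ℕ → ℝ) {l k : ℕ} (hk : k ≤ l) :
    chainRadius r l k = r k + 2 * chainRadius r l (k + 1) := by
  unfold chainRadius
  rw [Finset.sum_eq_sum_Ico_succ_bot (by omega), Finset.mul_sum]
  congr 1
  · simp
  · refine Finset.sum_congr rfl fun i hi => ?_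
    rw [Finset.mem_Ico] at hi
    rw [show i - k = (i - (k + 1)) + 1 by omega, pow_succ]
    ring

theorem chainRadius_nonneg {r : ℕ → ℝ} (hr : ∀ i, 0 ≤ r i) (l k : ℕ) :
    0 ≤ chainRadius r l k :=
  Finset.sum_nonneg fun i _ => mul_nonneg (by positivity) (hr i)

/-- Shifting the index by one in a weighted sum of chain radii gains a factor `R`. -/
theorem sum_pow_mul_chainRadius_succ_le {R : ℝ} (hR : 0 < R) {r : ℕ → ℝ} (hr : ∀ i, 0 ≤ r i)
    (l k : ℕ) :
    R * ∑ j ∈ Finset.Ico k (l + 1), R ^ j * chainRadius r l (j + 1) ≤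
      ∑ j ∈ Finset.Ico k (l + 1), R ^ j * chainRadius r l j := by
  have h1 : R * ∑ j ∈ Finset.Ico k (l + 1), R ^ j * chainRadius r l (j + 1) =
      ∑ j ∈ Finset.Ico (k + 1) (l + 1 + 1), R ^ j * chainRadius r l j := by
    rw [Finset.mul_sum, ← Finset.sum_Ico_add' (fun j => R ^ j * chainRadius r l j) k (l + 1) 1]
    refine Finset.sum_congr rfl fun i _ => ?_
    rw [pow_succ]
    ring
  have hnn : ∀ j, 0 ≤ R ^ j * chainRadius r l j := fun j =>
    mul_nonneg (by positivity) (chainRadius_nonneg hr l j)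
  rw [h1]
  by_cases hkl : k ≤ l
  · rw [Finset.sum_Ico_succ_top (by omega), chainRadius_succ_self, mul_zero, add_zero]
    exact Finset.sum_le_sum_of_subset_of_nonneg (Finset.Ico_subset_Ico_left (by omega))
      fun j _ _ => hnn j
  · rw [Finset.Ico_eq_empty (by omega), Finset.sum_empty]
    exact Finset.sum_nonneg fun j _ => hnn j

theorem sum_pow_mul_chainRadius_le {R : ℝ} (hR : 4 ≤ R) {r : ℕ → ℝ} (hr : ∀ i, 0 ≤ r i)
    (l k : ℕ) :
    ∑ j ∈ Finset.Ico k (l + 1), R ^ j * chainRadius r l j ≤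
      2 * ∑ j ∈ Finset.Ico k (l + 1), R ^ j * r j := by
  have h1 := sum_pow_mul_chainRadius_succ_le (by linarith : 0 < R) hr l k
  have h2 : ∑ j ∈ Finset.Ico k (l + 1), R ^ j * chainRadius r l j =
      ∑ j ∈ Finset.Ico k (l + 1), R ^ j * r j +
        2 * ∑ j ∈ Finset.Ico k (l + 1), R ^ j * chainRadius r l (j + 1) := by
    rw [Finset.mul_sum, ← Finset.sum_add_distrib]
    refine Finset.sum_congr rfl fun j hj => ?_
    rw [Finset.mem_Ico] at hj
    rw [chainRadius_eq r (by omega : j ≤ l)]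
    ring
  have h3 : 0 ≤ ∑ j ∈ Finset.Ico k (l + 1), R ^ j * chainRadius r l (j + 1) :=
    Finset.sum_nonneg fun j _ => mul_nonneg (by positivity) (chainRadius_nonneg hr l _)
  nlinarith

/-- Selection of the level at which chains started at two points at distance `d` are joined. -/
theorem exists_joining_level {R : ℝ} (hR : 16 ≤ R) {a b : ℕ → ℝ} (ha : ∀ i, 0 ≤ a i)
    (hb : ∀ i, 0 ≤ b i) {d : ℝ} (hd : 0 ≤ d) (hab : ∀ i, b i ≤ a i + d) {l : ℕ} (hl : a l ≤ d) :
    ∃ k ≤ l, (∀ j, k = j + 1 → d + 2 * chainRadius a l k + chainRadius b l k < a j) ∧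
      ∑ j ∈ Finset.Ico k (l + 1), R ^ j * (chainRadius a l j + chainRadius b l j) ≤
        8 * ∑ j ∈ Finset.range (l + 1), R ^ j * (min (a j) d + min (b j) d) := by
  classical
  let P : ℕ → Prop := fun k =>
    ∀ j, k = j + 1 → d + 2 * chainRadius a l k + chainRadius b l k < a j
  have hP0 : P 0 := fun j hj => by omega
  have hkl := Nat.findGreatest_le (P := P) l
  have hspec : P (Nat.findGreatest P l) := Nat.findGreatest_spec (P := P) (Nat.zero_le l) hP0
  have hmax : ∀ i, Nat.findGreatest P l < i → i ≤ l → ¬ P i := fun i h1 h2 =>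
    Nat.findGreatest_is_greatest h1 h2
  generalize Nat.findGreatest P l = k at hkl hspec hmax
  refine ⟨k, hkl, hspec, ?_⟩
  have key : ∀ i ∈ Finset.Ico k (l + 1),
      a i ≤ d + 2 * chainRadius a l (i + 1) + chainRadius b l (i + 1) := by
    intro i hi
    rw [Finset.mem_Ico] at hi
    rcases Nat.lt_or_ge i l with h | h
    · have := hmax (i + 1) (by omega) (by omega)
      simp only [P] at this
      push Not at this
      obtain ⟨j, hj, hj'⟩ := this
      obtain rfl : i = j := by omega
      exact hj'
    · obtain rfl : i = l := by omega
      simp only [chainRadius_succ_self]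
      linarith
  have hmin : ∀ i ∈ Finset.Ico k (l + 1), R ^ i * (a i + b i) ≤
      2 * (R ^ i * (min (a i) d + min (b i) d)) +
        4 * (R ^ i * chainRadius a l (i + 1) + R ^ i * chainRadius b l (i + 1)) := by
    intro i hi
    have h1 := key i hi
    have h2 := chainRadius_nonneg ha l (i + 1)
    have h3 := chainRadius_nonneg hb l (i + 1)
    have h4 := hab i
    have h5 := ha i
    have h6 := hb i
    have : a i + b i ≤ 2 * (min (a i) d + min (b i) d) +
        4 * (chainRadius a l (i + 1) + chainRadius b l (i + 1)) := by
      rcases le_total (a i) d with h | h <;> rcases le_total (b i) d with h' | h' <;>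
        simp only [min_eq_left h, min_eq_left h', min_eq_right h, min_eq_right h'] <;> linarith
    have hRi : 0 ≤ R ^ i := by positivity
    nlinarith [mul_le_mul_of_nonneg_left this hRi]
  have hsum := Finset.sum_le_sum hmin
  simp only [Finset.sum_add_distrib, ← Finset.mul_sum] at hsum
  have hsub : ∑ i ∈ Finset.Ico k (l + 1), R ^ i * (min (a i) d + min (b i) d) ≤
      ∑ i ∈ Finset.range (l + 1), R ^ i * (min (a i) d + min (b i) d) := by
    rw [Finset.range_eq_Ico]
    exact Finset.sum_le_sum_of_subset_of_nonneg (Finset.Ico_subset_Ico_left (Nat.zero_le k))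
      fun j _ _ => mul_nonneg (by positivity)
        (add_nonneg (le_min (ha j) hd) (le_min (hb j) hd))
  have hR0 : 0 < R := by linarith
  have hA := sum_pow_mul_chainRadius_succ_le hR0 ha l k
  have hB := sum_pow_mul_chainRadius_succ_le hR0 hb l k
  have hA' := sum_pow_mul_chainRadius_le (by linarith : 4 ≤ R) ha l k
  have hB' := sum_pow_mul_chainRadius_le (by linarith : 4 ≤ R) hb l k
  have hAn : 0 ≤ ∑ j ∈ Finset.Ico k (l + 1), R ^ j * chainRadius a l (j + 1) :=
    Finset.sum_nonneg fun j _ => mul_nonneg (by positivity) (chainRadius_nonneg ha l _)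
  have hBn : 0 ≤ ∑ j ∈ Finset.Ico k (l + 1), R ^ j * chainRadius b l (j + 1) :=
    Finset.sum_nonneg fun j _ => mul_nonneg (by positivity) (chainRadius_nonneg hb l _)
  simp only [mul_add, Finset.sum_add_distrib] at hsum hsub ⊢
  nlinarith

namespace IsYoungFunction

variable {φ : ℝ → ℝ}

theorem mul_le_mul (h : IsYoungFunction φ) {a y : ℝ} (ha : 0 ≤ a) (hay : a ≤ y) :
    y * φ a ≤ a * φ y := by
  rcases (ha.trans hay).eq_or_lt with hy | hy
  · obtain rfl : a = y := by linarith
    rfl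
  · have := h.2.1.2 (Set.mem_Ici.2 hy.le) (Set.mem_Ici.2 le_rfl) (div_nonneg ha hy.le)
      (by rw [sub_nonneg]; exact (div_le_one hy).2 hay) (by ring : a / y + (1 - a / y) = 1)
    simp only [smul_eq_mul, mul_zero, add_zero, h.2.2.1, div_mul_cancel₀ a hy.ne'] at this
    calc y * φ a ≤ y * (a / y * φ y) := by gcongr
      _ = a * φ y := by field_simp

theorem le_self_of_le_one (h : IsYoungFunction φ) (h1 : φ 1 = 1) {x : ℝ} (hx : 0 ≤ x)
    (hx1 : x ≤ 1) : φ x ≤ x := by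
  simpa [h1] using h.mul_le_mul hx hx1

theorem self_le_of_one_le (h : IsYoungFunction φ) (h1 : φ 1 = 1) {x : ℝ} (hx : 1 ≤ x) :
    x ≤ φ x := by
  simpa [h1] using h.mul_le_mul zero_le_one hx

theorem one_le_apply_pow (h : IsYoungFunction φ) (h1 : φ 1 = 1) {R : ℝ} (hR : 1 ≤ R) (k : ℕ) :
    1 ≤ φ (R ^ k) :=
  (one_le_pow₀ hR).trans (h.self_le_of_one_le h1 (one_le_pow₀ hR))

/-- Linearization of the identity by a truncated Young function at height `a`. -/
theorem le_mul_two_add (h : IsYoungFunction φ) (h1 : φ 1 = 1) {a y : ℝ} (ha : 1 ≤ a) :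
    y ≤ a * (2 + max (φ y - 1) 0 / φ a) := by
  have hφa : 1 ≤ φ a := ha.trans (h.self_le_of_one_le h1 ha)
  have hmax : 0 ≤ max (φ y - 1) 0 := le_max_right _ _
  rcases le_total y a with hy | hy
  · have : 0 ≤ max (φ y - 1) 0 / φ a := by positivity
    nlinarith
  · have h2 := h.mul_le_mul (zero_le_one.trans ha) hy
    have h3 : φ y - 1 ≤ max (φ y - 1) 0 := le_max_left _ _
    have h4 : y ≤ a * φ y / φ a := by rwa [le_div_iff₀ (by linarith)]
    have h5 : φ y / φ a ≤ 2 + max (φ y - 1) 0 / φ a := by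
      rw [div_le_iff₀ (by linarith), add_mul, div_mul_cancel₀ _ (by linarith)]
      linarith
    calc y ≤ a * φ y / φ a := h4
      _ = a * (φ y / φ a) := by ring
      _ ≤ _ := by gcongr

end IsYoungFunction

section MassRadius

variable {T : Type*} [MetricSpace T] [MeasurableSpace T]

/-- The smallest radius of a closed ball around `x` of mass at least `c`. -/
def massRadius (m : Measure T) (c : ℝ≥0∞) (x : T) : ℝ :=
  sInf {ε : ℝ | 0 ≤ ε ∧ c ≤ m (Metric.closedBall x ε)}

theorem massRadius_nonneg (m : Measure T) (c : ℝ≥0∞) (x : T) : 0 ≤ massRadius m c x :=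
  Real.sInf_nonneg fun _ h => h.1

theorem bddBelow_massRadius_set (m : Measure T) (c : ℝ≥0∞) (x : T) :
    BddBelow {ε : ℝ | 0 ≤ ε ∧ c ≤ m (Metric.closedBall x ε)} :=
  ⟨0, fun _ h => h.1⟩

theorem measure_closedBall_lt_of_lt_massRadius {m : Measure T} {c : ℝ≥0∞} {x : T} {ε : ℝ}
    (h0 : 0 ≤ ε) (h : ε < massRadius m c x) : m (Metric.closedBall x ε) < c := by
  by_contra! hc
  exact notMem_of_lt_csInf h (bddBelow_massRadius_set m c x) ⟨h0, hc⟩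

theorem massRadius_le {m : Measure T} {c : ℝ≥0∞} {x : T} {ε : ℝ} (h0 : 0 ≤ ε)
    (h : c ≤ m (Metric.closedBall x ε)) : massRadius m c x ≤ ε :=
  csInf_le (bddBelow_massRadius_set m c x) ⟨h0, h⟩

theorem measure_ball_massRadius_le (m : Measure T) (c : ℝ≥0∞) (x : T) :
    m (Metric.ball x (massRadius m c x)) ≤ c := by
  have hu : Metric.ball x (massRadius m c x) =
      ⋃ n : ℕ, Metric.closedBall x (massRadius m c x - 1 / ((n : ℝ) + 1)) := by
    ext y
    simp only [Metric.mem_ball, Set.mem_iUnion, Metric.mem_closedBall]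
    constructor
    · intro h
      obtain ⟨n, hn⟩ := exists_nat_one_div_lt (sub_pos.2 h)
      exact ⟨n, by linarith⟩
    · rintro ⟨n, hn⟩
      have : (0 : ℝ) < 1 / ((n : ℝ) + 1) := Nat.one_div_pos_of_nat
      linarith
  have hmono : Monotone fun n : ℕ =>
      Metric.closedBall x (massRadius m c x - 1 / ((n : ℝ) + 1)) := fun i j hij =>
    Metric.closedBall_subset_closedBall (sub_le_sub_left (Nat.one_div_le_one_div hij) _)
  have ht := tendsto_measure_iUnion_atTop (μ := m) hmono
  rw [← hu] at ht
  refine le_of_tendsto' ht fun n => ?_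
  have hn : (0 : ℝ) < 1 / ((n : ℝ) + 1) := Nat.one_div_pos_of_nat
  rcases lt_or_ge (massRadius m c x - 1 / ((n : ℝ) + 1)) 0 with h | h
  · rw [Function.comp_apply, Metric.closedBall_eq_empty.2 h, measure_empty]
    exact zero_le
  · exact (measure_closedBall_lt_of_lt_massRadius h (by linarith)).le

/-- Density with respect to `m` of the conditional law of `m` on the smallest closed ball
around `u` of mass at least `c`. -/
def ballDensity (m : Measure T) (c : ℝ≥0∞) (q : T × T) : ℝ≥0∞ :=
  {q : T × T | dist q.1 q.2 ≤ massRadius m c q.1}.indicator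
    (fun q => (m (Metric.closedBall q.1 (massRadius m c q.1)))⁻¹) q

theorem dist_le_of_ballDensity_ne_zero {m : Measure T} {c : ℝ≥0∞} {q : T × T}
    (h : ballDensity m c q ≠ 0) : dist q.1 q.2 ≤ massRadius m c q.1 := by
  by_contra hq
  exact h (Set.indicator_of_notMem (s := {q : T × T | dist q.1 q.2 ≤ massRadius m c q.1}) hq _)

/-- Normalized weight of the off-diagonal strip `d(u,v) < r(u)`, of total mass at most one. -/
def stripDensity (m : Measure T) (c : ℝ≥0∞) (q : T × T) : ℝ≥0∞ :=
  {q : T × T | dist q.1 q.2 < massRadius m c q.1}.indicator (fun _ => c⁻¹) q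

variable [BorelSpace T] [CompactSpace T] (m : Measure T) [IsProbabilityMeasure m] {c : ℝ≥0∞}

theorem le_measure_closedBall_massRadius (hc : c ≤ 1) (x : T) :
    c ≤ m (Metric.closedBall x (massRadius m c x)) := by
  have hne : {ε : ℝ | 0 ≤ ε ∧ c ≤ m (Metric.closedBall x ε)}.Nonempty := by
    refine ⟨Metric.diam (Set.univ : Set T), Metric.diam_nonneg, ?_⟩
    have : Metric.closedBall x (Metric.diam (Set.univ : Set T)) = Set.univ :=
      Set.eq_univ_of_forall fun y => Metric.mem_closedBall.2
        (Metric.dist_le_diam_of_mem isCompact_univ.isBounded trivial trivial)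
    rwa [this, measure_univ]
  have hu : Metric.closedBall x (massRadius m c x) =
      ⋂ n : ℕ, Metric.closedBall x (massRadius m c x + 1 / ((n : ℝ) + 1)) := by
    ext y
    simp only [Metric.mem_closedBall, Set.mem_iInter]
    constructor
    · intro h n
      have : (0 : ℝ) < 1 / ((n : ℝ) + 1) := Nat.one_div_pos_of_nat
      linarith
    · intro h
      refine le_of_forall_pos_lt_add fun e he => ?_
      obtain ⟨n, hn⟩ := exists_nat_one_div_lt he
      have := h n
      linarith
  have hanti : Antitone fun n : ℕ =>
      Metric.closedBall x (massRadius m c x + 1 / ((n : ℝ) + 1)) := fun i j hij =>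
    Metric.closedBall_subset_closedBall (add_le_add_right (Nat.one_div_le_one_div hij) _)
  have ht := tendsto_measure_iInter_atTop (μ := m)
    (fun n : ℕ => (measurableSet_closedBall : MeasurableSet (Metric.closedBall x
      (massRadius m c x + 1 / ((n : ℝ) + 1)))).nullMeasurableSet) hanti ⟨0, measure_ne_top _ _⟩
  rw [← hu] at ht
  refine ge_of_tendsto' ht fun n => ?_
  have hn : (0 : ℝ) < 1 / ((n : ℝ) + 1) := Nat.one_div_pos_of_nat
  obtain ⟨e, he, he'⟩ := exists_lt_of_csInf_lt hne
    (show massRadius m c x < massRadius m c x + 1 / ((n : ℝ) + 1) by linarith)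
  exact he.2.trans (measure_mono (Metric.closedBall_subset_closedBall he'.le))

theorem massRadius_le_add_dist (hc : c ≤ 1) (x y : T) :
    massRadius m c x ≤ massRadius m c y + dist x y := by
  refine massRadius_le (add_nonneg (massRadius_nonneg m c y) dist_nonneg)
    ((le_measure_closedBall_massRadius m hc y).trans (measure_mono ?_))
  exact Metric.closedBall_subset_closedBall' (by rw [dist_comm y x])

theorem continuous_massRadius (hc : c ≤ 1) : Continuous (massRadius m c) := by
  refine LipschitzWith.continuous (K := 1) (LipschitzWith.of_le_add fun x y => ?_)
  exact massRadius_le_add_dist m hc x y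

theorem ballDensity_le (hc : c ≤ 1) (q : T × T) : ballDensity m c q ≤ c⁻¹ :=
  Set.indicator_apply_le' (fun _ => ENNReal.inv_le_inv.2 (le_measure_closedBall_massRadius m hc _))
    fun _ => zero_le

theorem measurable_ballDensity (hc : c ≤ 1) : Measurable (ballDensity m c) := by
  have hr := continuous_massRadius m hc
  have hS : MeasurableSet {q : T × T | dist q.1 q.2 ≤ massRadius m c q.1} :=
    (isClosed_le continuous_dist (hr.comp continuous_fst)).measurableSet
  refine Measurable.indicator (Measurable.inv ?_) hS
  have : Measurable fun q : T × T =>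
      m (Prod.mk q.1 ⁻¹' {q : T × T | dist q.1 q.2 ≤ massRadius m c q.1}) :=
    (measurable_measure_prodMk_left (ν := m) hS).comp measurable_fst
  convert this using 2 with q
  congr 1
  ext y
  simp [dist_comm]

theorem lintegral_ballDensity (hc : c ≤ 1) (hc0 : c ≠ 0) (u : T) :
    ∫⁻ v, ballDensity m c (u, v) ∂m = 1 := by
  have h : (fun v => ballDensity m c (u, v)) =
      (Metric.closedBall u (massRadius m c u)).indicator
        fun _ => (m (Metric.closedBall u (massRadius m c u)))⁻¹ := by
    ext v
    simp only [ballDensity, Set.indicator, Set.mem_ofPred_eq, Metric.mem_closedBall, dist_comm v u]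
  rw [h, lintegral_indicator measurableSet_closedBall, setLIntegral_const]
  refine ENNReal.inv_mul_cancel ?_ (measure_ne_top _ _)
  exact ((pos_iff_ne_zero.2 hc0).trans_le (le_measure_closedBall_massRadius m hc u)).ne'

theorem measurable_stripDensity (hc : c ≤ 1) : Measurable (stripDensity m c) :=
  measurable_const.indicator
    (isOpen_lt continuous_dist ((continuous_massRadius m hc).comp continuous_fst)).measurableSet

theorem lintegral_stripDensity_le (hc : c ≤ 1) :
    ∫⁻ q, stripDensity m c q ∂(m.prod m) ≤ 1 := by
  rw [lintegral_prod _ (measurable_stripDensity m hc).aemeasurable]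
  refine (lintegral_mono fun u => ?_).trans_eq (by simp : ∫⁻ _ : T, 1 ∂m = 1)
  have h : (fun v => stripDensity m c (u, v)) =
      (Metric.ball u (massRadius m c u)).indicator fun _ => c⁻¹ := by
    ext v
    simp only [stripDensity, Set.indicator, Set.mem_ofPred_eq, Metric.mem_ball, dist_comm v u]
  simp only [h]
  rw [lintegral_indicator measurableSet_ball, setLIntegral_const]
  calc c⁻¹ * m (Metric.ball u (massRadius m c u)) ≤ c⁻¹ * c := by
        gcongr
        exact measure_ball_massRadius_le m c u
    _ ≤ 1 := ENNReal.inv_mul_le_one c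

end MassRadius

section Energy

variable {T : Type*} [MetricSpace T]

/-- The integrand `ψ₊(|f^d| / b)` of the Luxemburg norm of `f^d`. -/
def energyDensity (ψ : ℝ → ℝ) (f : T → ℝ) (b : ℝ) (q : T × T) : ℝ≥0∞ :=
  ENNReal.ofReal (max (ψ (|fdiv f q| / b) - 1) 0)

theorem abs_sub_le_energyDensity {ψ : ℝ → ℝ} (hψ : IsYoungFunction ψ) (hψ1 : ψ 1 = 1)
    (f : T → ℝ) {a b : ℝ} (ha : 1 ≤ a) (hb : 0 < b) (q : T × T) :
    ENNReal.ofReal |f q.1 - f q.2| ≤ ENNReal.ofReal (b * (a * dist q.1 q.2)) *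
      (2 + (ENNReal.ofReal (ψ a))⁻¹ * energyDensity ψ f b q) := by
  have hψa : 0 < ψ a := zero_lt_one.trans_le (ha.trans (hψ.self_le_of_one_le hψ1 ha))
  have hreal : |f q.1 - f q.2| ≤
      b * (a * dist q.1 q.2) * (2 + (ψ a)⁻¹ * max (ψ (|fdiv f q| / b) - 1) 0) := by
    rcases eq_or_ne q.1 q.2 with h | h
    · simp [h]
    · have hd : 0 < dist q.1 q.2 := dist_pos.2 h
      have h1 := hψ.le_mul_two_add hψ1 (y := |fdiv f q| / b) ha
      have h2 : |f q.1 - f q.2| = b * dist q.1 q.2 * (|fdiv f q| / b) := by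
        rw [fdiv, abs_div, abs_abs, abs_of_pos hd]
        field_simp
      rw [h2]
      calc b * dist q.1 q.2 * (|fdiv f q| / b)
          ≤ b * dist q.1 q.2 * (a * (2 + max (ψ (|fdiv f q| / b) - 1) 0 / ψ a)) := by gcongr
        _ = _ := by rw [div_eq_inv_mul]; ring
  have hm : 0 ≤ max (ψ (|fdiv f q| / b) - 1) 0 := le_max_right _ _
  refine (ENNReal.ofReal_le_ofReal hreal).trans_eq ?_
  rw [ENNReal.ofReal_mul (by positivity : 0 ≤ b * (a * dist q.1 q.2)),
    ENNReal.ofReal_add (by norm_num) (by positivity),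
    ENNReal.ofReal_mul (by positivity : 0 ≤ (ψ a)⁻¹), ENNReal.ofReal_inv_of_pos hψa, energyDensity]
  simp

variable [CompactSpace T] [MeasurableSpace T] [BorelSpace T]

theorem measurable_energyDensity {ψ : ℝ → ℝ} (hψ : IsYoungFunction ψ) {f : T → ℝ}
    (hf : Continuous f) {b : ℝ} (hb : 0 < b) : Measurable (energyDensity ψ f b) := by
  have hmono : Monotone fun x => ψ (max x 0) := fun x y hxy =>
    hψ.1 (Set.mem_Ici.2 (le_max_right _ _)) (Set.mem_Ici.2 (le_max_right _ _))
      (max_le_max_right 0 hxy)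
  have hfd : Measurable (fdiv f) :=
    ((hf.comp continuous_fst).sub (hf.comp continuous_snd)).abs.measurable.div
      continuous_dist.measurable
  have h : energyDensity ψ f b = fun q =>
      ENNReal.ofReal (max ((fun x => ψ (max x 0)) (|fdiv f q| / b) - 1) 0) := by
    ext q
    have : 0 ≤ |fdiv f q| / b := by positivity
    simp only [energyDensity, max_eq_left this]
  rw [h]
  have h1 : Measurable fun q => (fun x => ψ (max x 0)) (|fdiv f q| / b) :=
    hmono.measurable.comp ((continuous_abs.measurable.comp hfd).div_const b)
  exact ((h1.sub_const 1).max measurable_const).ennreal_ofReal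

theorem lintegral_mul_abs_sub_le {ψ : ℝ → ℝ} (hψ : IsYoungFunction ψ) (hψ1 : ψ 1 = 1)
    {f : T → ℝ} (hf : Continuous f) {a b D L : ℝ} (ha : 1 ≤ a) (hb : 0 < b) (hD : 0 ≤ D)
    (hL : 0 ≤ L) (M : Measure (T × T)) {F : T × T → ℝ≥0∞} (hF : Measurable F)
    (hFD : ∀ q, F q ≠ 0 → dist q.1 q.2 ≤ D) (hF1 : ∫⁻ q, F q ∂M ≤ 1)
    (hFG : ∫⁻ q, F q * energyDensity ψ f b q ∂M ≤ ENNReal.ofReal (L * ψ a)) :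
    ∫⁻ q, F q * ENNReal.ofReal |f q.1 - f q.2| ∂M ≤
      ENNReal.ofReal (b * (2 + L) * (a * D)) := by
  have hψa : 0 < ψ a := zero_lt_one.trans_le (ha.trans (hψ.self_le_of_one_le hψ1 ha))
  have hG := measurable_energyDensity hψ hf hb
  have hpt : ∀ q, F q * ENNReal.ofReal |f q.1 - f q.2| ≤ ENNReal.ofReal (b * (a * D)) *
      (2 * F q + (ENNReal.ofReal (ψ a))⁻¹ * (F q * energyDensity ψ f b q)) := by
    intro q
    by_cases hq : F q = 0
    · simp [hq]
    · have hq' := hFD q hq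
      calc F q * ENNReal.ofReal |f q.1 - f q.2|
          ≤ F q * (ENNReal.ofReal (b * (a * dist q.1 q.2)) *
            (2 + (ENNReal.ofReal (ψ a))⁻¹ * energyDensity ψ f b q)) := by
            gcongr
            exact abs_sub_le_energyDensity hψ hψ1 f ha hb q
        _ ≤ F q * (ENNReal.ofReal (b * (a * D)) *
            (2 + (ENNReal.ofReal (ψ a))⁻¹ * energyDensity ψ f b q)) := by gcongr
        _ = _ := by ring
  refine (lintegral_mono hpt).trans ?_
  rw [lintegral_const_mul _ (by fun_prop), lintegral_add_left (by fun_prop),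
    lintegral_const_mul _ hF, lintegral_const_mul _ (by fun_prop)]
  have hc : (ENNReal.ofReal (ψ a))⁻¹ * ENNReal.ofReal (L * ψ a) = ENNReal.ofReal L := by
    rw [ENNReal.ofReal_mul hL, mul_comm, mul_assoc, ENNReal.mul_inv_cancel, mul_one]
    · exact (ENNReal.ofReal_pos.2 hψa).ne'
    · exact ENNReal.ofReal_ne_top
  calc _ ≤ ENNReal.ofReal (b * (a * D)) *
        (2 * 1 + (ENNReal.ofReal (ψ a))⁻¹ * ENNReal.ofReal (L * ψ a)) := by gcongr
    _ = _ := by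
      rw [hc, mul_one, show b * (2 + L) * (a * D) = b * (a * D) * (2 + L) by ring,
        ENNReal.ofReal_mul (by positivity : 0 ≤ b * (a * D)),
        ENNReal.ofReal_add (by norm_num) hL]
      simp

end Energy

theorem ofReal_abs_sub_le_add {T : Type*} (f : T → ℝ) (u v : T) (x : ℝ) :
    ENNReal.ofReal |f u - x| ≤ ENNReal.ofReal |f u - f v| + ENNReal.ofReal |f v - x| := by
  rw [← ENNReal.ofReal_add (abs_nonneg _) (abs_nonneg _)]
  exact ENNReal.ofReal_le_ofReal (abs_sub_le _ _ _)

section Chain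

variable {T : Type*} [MetricSpace T] [CompactSpace T] [MeasurableSpace T] [BorelSpace T]

/-- The density of the law at level `k` of a random chain started at `s` and descending through
the balls of the levels `l, l - 1, …, k`, together with the resulting chaining bound. -/
theorem exists_chain_density (m : Measure T) [IsProbabilityMeasure m] {p : ℕ → ℝ≥0∞}
    (hp1 : ∀ k, 1 ≤ p k) (hpt : ∀ k, p k ≠ ⊤) {ψ : ℝ → ℝ} (hψ : IsYoungFunction ψ)
    (hψ1 : ψ 1 = 1) {f : T → ℝ} (hf : Continuous f) {b : ℝ} (hb : 0 < b) {a : ℕ → ℝ}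
    (ha : ∀ k, 1 ≤ a k) {L : ℝ} (hL : 0 ≤ L)
    (henergy : ∀ k, p (k + 1) *
      ∫⁻ q, ballDensity m (p k)⁻¹ q * energyDensity ψ f b q ∂(m.prod m) ≤
        ENNReal.ofReal (L * ψ (a k)))
    (s : T) (l : ℕ) {η : ℝ≥0∞}
    (hη : ∀ u, dist s u ≤ massRadius m (p l)⁻¹ s → ENNReal.ofReal |f s - f u| ≤ η)
    (k : ℕ) (hk : k ≤ l) :
    ∃ h : T → ℝ≥0∞, Measurable h ∧ ∫⁻ u, h u ∂m = 1 ∧ (∀ u, h u ≤ p k) ∧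
      (∀ u, h u ≠ 0 → dist s u ≤ chainRadius (fun j => massRadius m (p j)⁻¹ s) l k) ∧
      ∀ x : ℝ, ENNReal.ofReal |f s - x| ≤
        η + ∑ j ∈ Finset.Ico k l, ENNReal.ofReal (b * (2 + L) *
          (a j * chainRadius (fun j => massRadius m (p j)⁻¹ s) l j)) +
        ∫⁻ u, h u * ENNReal.ofReal |f u - x| ∂m := by
  set r : ℕ → ℝ := fun j => massRadius m (p j)⁻¹ s with hr
  have hr0 : ∀ j, 0 ≤ r j := fun j => massRadius_nonneg _ _ _
  have hc : ∀ k, (p k)⁻¹ ≤ 1 := fun k => ENNReal.inv_le_one.2 (hp1 k)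
  have hc0 : ∀ k, (p k)⁻¹ ≠ 0 := fun k => ENNReal.inv_ne_zero.2 (hpt k)
  have hw : ∀ k, Measurable (ballDensity m (p k)⁻¹) := fun k => measurable_ballDensity m (hc k)
  have hwle : ∀ k q, ballDensity m (p k)⁻¹ q ≤ p k := fun k q => by
    simpa using ballDensity_le m (hc k) q
  have hfm : Measurable f := hf.measurable
  induction hk using Nat.decreasingInduction with
  | self =>
    have hm : Measurable fun u => ballDensity m (p l)⁻¹ (s, u) :=
      (hw l).comp measurable_prodMk_left
    have h1 := lintegral_ballDensity m (hc l) (hc0 l) s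
    have hsupp : ∀ u, ballDensity m (p l)⁻¹ (s, u) ≠ 0 → dist s u ≤ r l :=
      fun u hu => dist_le_of_ballDensity_ne_zero hu
    refine ⟨fun u => ballDensity m (p l)⁻¹ (s, u), hm, h1, fun u => hwle l _,
      fun u hu => ?_, fun x => ?_⟩
    · rw [chainRadius_eq r le_rfl, chainRadius_succ_self]
      simpa using hsupp u hu
    · rw [Finset.Ico_self, Finset.sum_empty, add_zero]
      calc ENNReal.ofReal |f s - x|
          = ∫⁻ u, ballDensity m (p l)⁻¹ (s, u) * ENNReal.ofReal |f s - x| ∂m := by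
            rw [lintegral_mul_const _ hm, h1, one_mul]
        _ ≤ ∫⁻ u, (ballDensity m (p l)⁻¹ (s, u) * η +
              ballDensity m (p l)⁻¹ (s, u) * ENNReal.ofReal |f u - x|) ∂m := by
            refine lintegral_mono fun u => ?_
            by_cases hu : ballDensity m (p l)⁻¹ (s, u) = 0
            · simp [hu]
            · rw [← mul_add]
              gcongr
              exact (ofReal_abs_sub_le_add f s u x).trans (by
                gcongr
                exact hη u (hsupp u hu))
        _ = _ := by rw [lintegral_add_left (hm.mul_const _), lintegral_mul_const _ hm, h1, one_mul]
  | of_succ k hk ih =>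
    obtain ⟨h, hm, h1, hle, hsupp, hbound⟩ := ih
    have hF : Measurable fun q : T × T => h q.1 * ballDensity m (p k)⁻¹ q :=
      (hm.comp measurable_fst).mul (hw k)
    have hdist : ∀ u v, h u * ballDensity m (p k)⁻¹ (u, v) ≠ 0 →
        dist s u ≤ chainRadius r l (k + 1) ∧
          dist u v ≤ r k + chainRadius r l (k + 1) := by
      intro u v huv
      have h2 := hsupp u (left_ne_zero_of_mul huv)
      have h3 : dist u v ≤ massRadius m (p k)⁻¹ u :=
        dist_le_of_ballDensity_ne_zero (right_ne_zero_of_mul huv)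
      have h4 := massRadius_le_add_dist m (hc k) u s
      rw [dist_comm u s] at h4
      exact ⟨h2, h3.trans (h4.trans (by gcongr))⟩
    have hρ0 := chainRadius_nonneg hr0 l (k + 1)
    have hρ := chainRadius_eq r hk.le
    have hint : ∀ g : T × T → ℝ≥0∞, Measurable g →
        ∫⁻ q, h q.1 * ballDensity m (p k)⁻¹ q * g q ∂(m.prod m) =
          ∫⁻ u, h u * ∫⁻ v, ballDensity m (p k)⁻¹ (u, v) * g (u, v) ∂m ∂m := by
      intro g hg
      have hFg : Measurable fun q : T × T => h q.1 * ballDensity m (p k)⁻¹ q * g q := hF.mul hg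
      rw [lintegral_prod _ hFg.aemeasurable]
      refine lintegral_congr fun u => ?_
      have hwg : Measurable fun v => ballDensity m (p k)⁻¹ (u, v) * g (u, v) :=
        ((hw k).mul hg).comp measurable_prodMk_left
      rw [← lintegral_const_mul _ hwg]
      exact lintegral_congr fun v => mul_assoc _ _ _
    have hint' : ∀ g : T → ℝ≥0∞, Measurable g →
        ∫⁻ q, h q.1 * ballDensity m (p k)⁻¹ q * g q.2 ∂(m.prod m) =
          ∫⁻ v, (∫⁻ u, h u * ballDensity m (p k)⁻¹ (u, v) ∂m) * g v ∂m := by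
      intro g hg
      have hFg : Measurable fun q : T × T => h q.1 * ballDensity m (p k)⁻¹ q * g q.2 :=
        hF.mul (hg.comp measurable_snd)
      rw [lintegral_prod_symm _ hFg.aemeasurable]
      refine lintegral_congr fun v => ?_
      have hFv : Measurable fun u => h u * ballDensity m (p k)⁻¹ (u, v) :=
        hF.comp measurable_prodMk_right
      exact lintegral_mul_const (g v) hFv
    have hF1 : ∫⁻ q, h q.1 * ballDensity m (p k)⁻¹ q ∂(m.prod m) = 1 := by
      have := hint (fun _ => 1) measurable_const
      simpa [lintegral_ballDensity m (hc k) (hc0 k), h1] using this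
    refine ⟨fun v => ∫⁻ u, h u * ballDensity m (p k)⁻¹ (u, v) ∂m, hF.lintegral_prod_left', ?_,
      fun v => ?_, fun v hv => ?_, fun x => ?_⟩
    · have := hint' (fun _ => 1) measurable_const
      simpa [hF1] using this.symm
    · calc ∫⁻ u, h u * ballDensity m (p k)⁻¹ (u, v) ∂m ≤ ∫⁻ u, h u * p k ∂m := by
            gcongr with u
            exact hwle k _
        _ = p k := by rw [lintegral_mul_const _ hm, h1, one_mul]
    · obtain ⟨u, hu⟩ : ∃ u, h u * ballDensity m (p k)⁻¹ (u, v) ≠ 0 := by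
        by_contra! h0
        exact hv (by simp [h0])
      obtain ⟨h2, h3⟩ := hdist u v hu
      have := dist_triangle s u v
      rw [hρ]
      linarith
    · have hstep : ∫⁻ u, h u * ENNReal.ofReal |f u - x| ∂m ≤
          ENNReal.ofReal (b * (2 + L) * (a k * chainRadius r l k)) +
            ∫⁻ v, (∫⁻ u, h u * ballDensity m (p k)⁻¹ (u, v) ∂m) *
              ENNReal.ofReal |f v - x| ∂m := by
        rw [← hint' (fun v => ENNReal.ofReal |f v - x|) (by fun_prop)]
        have hE := lintegral_mul_abs_sub_le hψ hψ1 hf (ha k) hb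
          (chainRadius_nonneg hr0 l k) hL (m.prod m) hF
          (fun q hq => (hdist q.1 q.2 hq).2.trans (by rw [hρ]; linarith)) hF1.le (by
            refine le_trans ?_ (henergy k)
            have hwG : Measurable fun q => ballDensity m (p k)⁻¹ q * energyDensity ψ f b q :=
              (hw k).mul (measurable_energyDensity hψ hf hb)
            rw [← lintegral_const_mul _ hwG]
            refine lintegral_mono fun q => ?_
            rw [mul_assoc]
            gcongr
            exact hle q.1)
        refine le_trans ?_ (add_le_add_left hE _)
        have hFf : Measurable fun q : T × T =>
            h q.1 * ballDensity m (p k)⁻¹ q * ENNReal.ofReal |f q.1 - f q.2| :=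
          hF.mul (by fun_prop)
        rw [← lintegral_add_left hFf]
        have hx : ∫⁻ u, h u * ENNReal.ofReal |f u - x| ∂m =
            ∫⁻ q, h q.1 * ballDensity m (p k)⁻¹ q * ENNReal.ofReal |f q.1 - x| ∂(m.prod m) := by
          rw [hint (fun q => ENNReal.ofReal |f q.1 - x|) (by fun_prop)]
          refine lintegral_congr fun u => ?_
          have hwu : Measurable fun v => ballDensity m (p k)⁻¹ (u, v) :=
            (hw k).comp measurable_prodMk_left
          dsimp only
          rw [lintegral_mul_const _ hwu,
            lintegral_ballDensity m (hc k) (hc0 k), one_mul]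
        rw [hx]
        refine lintegral_mono fun q => ?_
        rw [← mul_add]
        gcongr
        exact ofReal_abs_sub_le_add f _ _ _
      refine (hbound x).trans ?_
      rw [Finset.sum_eq_sum_Ico_succ_bot hk]
      refine (add_le_add_right hstep _).trans_eq ?_
      abel

end Chain

section Join

variable {T : Type*} [MetricSpace T] [MeasurableSpace T]

/-- The weight controlling the joining of two chains at level `k`. -/
def joinDensity (m : Measure T) (p : ℕ → ℝ≥0∞) : ℕ → T × T → ℝ≥0∞
  | 0 => fun _ => 1
  | k + 1 => stripDensity m (p k)⁻¹

variable [CompactSpace T] [BorelSpace T] (m : Measure T) [IsProbabilityMeasure m]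
  {p : ℕ → ℝ≥0∞}

theorem measurable_joinDensity (hp1 : ∀ k, 1 ≤ p k) (k : ℕ) : Measurable (joinDensity m p k) := by
  cases k with
  | zero => exact measurable_const
  | succ k => exact measurable_stripDensity m (ENNReal.inv_le_one.2 (hp1 k))

theorem lintegral_joinDensity_le (hp1 : ∀ k, 1 ≤ p k) (k : ℕ) :
    ∫⁻ q, joinDensity m p k q ∂(m.prod m) ≤ 1 := by
  cases k with
  | zero => simp [joinDensity]
  | succ k => exact lintegral_stripDensity_le m (ENNReal.inv_le_one.2 (hp1 k))

theorem abs_sub_le_of_energy (hp0 : p 0 = 1) (hp1 : ∀ k, 1 ≤ p k) (hpt : ∀ k, p k ≠ ⊤)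
    (hplog : ∀ k, p (k + 1) * p (k + 1) ≤ p (k + 2) * p k) {ψ : ℝ → ℝ}
    (hψ : IsYoungFunction ψ) (hψ1 : ψ 1 = 1) {f : T → ℝ} (hf : Continuous f) {b : ℝ}
    (hb : 0 < b) {R : ℝ} (hR : 16 ≤ R) (n : ℕ) {L : ℝ} (hL : 0 ≤ L)
    (henergy : ∀ k, p (k + 1) *
      ∫⁻ q, ballDensity m (p k)⁻¹ q * energyDensity ψ f b q ∂(m.prod m) ≤
        ENNReal.ofReal (L * ψ (R ^ (k + n))))
    (henergy' : ∀ k, p (k + 1) *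
      ∫⁻ q, joinDensity m p k q * energyDensity ψ f b q ∂(m.prod m) ≤
        ENNReal.ofReal (L * ψ (R ^ (k + n))))
    (s t : T) (l : ℕ) {η : ℝ≥0∞} (hls : massRadius m (p l)⁻¹ s ≤ dist s t)
    (hηs : ∀ u, dist s u ≤ massRadius m (p l)⁻¹ s → ENNReal.ofReal |f s - f u| ≤ η)
    (hηt : ∀ u, dist t u ≤ massRadius m (p l)⁻¹ t → ENNReal.ofReal |f t - f u| ≤ η) :
    ENNReal.ofReal |f s - f t| ≤ 2 * η + ENNReal.ofReal (b * (2 + L) * (R ^ n * (dist s t +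
      (R + 16) * ∑ j ∈ Finset.range (l + 1), R ^ j *
        (min (massRadius m (p j)⁻¹ s) (dist s t) + min (massRadius m (p j)⁻¹ t) (dist s t))))) := by
  set r : ℕ → ℝ := fun j => massRadius m (p j)⁻¹ s with hr
  set r' : ℕ → ℝ := fun j => massRadius m (p j)⁻¹ t with hr'
  have hr0 : ∀ j, 0 ≤ r j := fun j => massRadius_nonneg _ _ _
  have hr0' : ∀ j, 0 ≤ r' j := fun j => massRadius_nonneg _ _ _
  have hc : ∀ k, (p k)⁻¹ ≤ 1 := fun k => ENNReal.inv_le_one.2 (hp1 k)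
  have hR1 : 1 ≤ R := by linarith
  have ha : ∀ k, 1 ≤ R ^ (k + n) := fun k => one_le_pow₀ hR1
  obtain ⟨k, hkl, hsel, hsum⟩ := exists_joining_level hR hr0 hr0' dist_nonneg
    (fun i => (massRadius_le_add_dist m (hc i) t s).trans_eq (by rw [dist_comm t s])) hls
  obtain ⟨h, hm, h1, hle, hsupp, hbound⟩ :=
    exists_chain_density m hp1 hpt hψ hψ1 hf hb ha hL henergy s l hηs k hkl
  obtain ⟨h', hm', h1', hle', hsupp', hbound'⟩ :=
    exists_chain_density m hp1 hpt hψ hψ1 hf hb ha hL henergy t l hηt k hkl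
  have hα := chainRadius_nonneg hr0 l k
  have hβ := chainRadius_nonneg hr0' l k
  have hfm : Measurable f := hf.measurable
  set D : ℝ := dist s t + chainRadius r l k + chainRadius r' l k with hD
  have hD0 : 0 ≤ D := by have := dist_nonneg (x := s) (y := t); positivity
  have hF : Measurable fun q : T × T => h q.1 * h' q.2 :=
    (hm.comp measurable_fst).mul (hm'.comp measurable_snd)
  have hFD : ∀ q : T × T, h q.1 * h' q.2 ≠ 0 → dist q.1 q.2 ≤ D := by
    intro q hq
    have h2 := hsupp _ (left_ne_zero_of_mul hq)
    have h3 := hsupp' _ (right_ne_zero_of_mul hq)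
    have h4 := dist_triangle4 q.1 s t q.2
    rw [dist_comm q.1 s] at h4
    rw [hD]
    linarith
  have hFle : ∀ q : T × T, h q.1 * h' q.2 ≤ p (k + 1) * joinDensity m p k q := by
    intro q
    by_cases hq : h q.1 * h' q.2 = 0
    · rw [hq]
      exact zero_le
    · have hprod : h q.1 * h' q.2 ≤ p k * p k := mul_le_mul' (hle _) (hle' _)
      cases k with
      | zero =>
        refine hprod.trans ?_
        simp only [hp0, joinDensity, mul_one]
        exact hp1 1
      | succ k =>
        have h2 : dist s q.1 ≤ chainRadius r l (k + 1) := hsupp _ (left_ne_zero_of_mul hq)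
        have h3 := hFD q hq
        have h4 := hsel k rfl
        have h5 := massRadius_le_add_dist m (hc k) s q.1
        have h6 : dist q.1 q.2 < massRadius m (p k)⁻¹ q.1 := by
          have : r k = massRadius m (p k)⁻¹ s := by rw [hr]
          linarith
        have h7 : joinDensity m p (k + 1) q = p k := by
          rw [joinDensity, stripDensity, Set.indicator_of_mem
            (s := {q : T × T | dist q.1 q.2 < massRadius m (p k)⁻¹ q.1}) h6, inv_inv]
        rw [h7]
        exact hprod.trans (hplog k)
  have hF1 : ∫⁻ q, h q.1 * h' q.2 ∂(m.prod m) ≤ 1 := by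
    rw [lintegral_prod_mul hm.aemeasurable hm'.aemeasurable, h1, h1', one_mul]
  have htop := lintegral_mul_abs_sub_le hψ hψ1 hf (ha k) hb hD0 hL (m.prod m) hF hFD hF1 (by
    refine le_trans ?_ (henergy' k)
    have hjG : Measurable fun q => joinDensity m p k q * energyDensity ψ f b q :=
      (measurable_joinDensity m hp1 k).mul (measurable_energyDensity hψ hf hb)
    rw [← lintegral_const_mul _ hjG]
    refine lintegral_mono fun q => ?_
    rw [← mul_assoc]
    exact mul_le_mul' (hFle q) le_rfl)
  have hFf : Measurable fun q : T × T => h q.1 * h' q.2 * ENNReal.ofReal |f q.1 - f q.2| :=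
    hF.mul (by fun_prop)
  set S := ∑ j ∈ Finset.Ico k l, ENNReal.ofReal (b * (2 + L) * (R ^ (j + n) * chainRadius r l j))
    with hS
  set S' := ∑ j ∈ Finset.Ico k l, ENNReal.ofReal (b * (2 + L) * (R ^ (j + n) * chainRadius r' l j))
    with hS'
  have hmain : ENNReal.ofReal |f s - f t| ≤
      2 * η + (S + S' + ENNReal.ofReal (b * (2 + L) * (R ^ (k + n) * D))) := by
    have hj : ∫⁻ u, h u * ENNReal.ofReal |f u - f t| ∂m ≤
        η + S' + ∫⁻ q, h q.1 * h' q.2 * ENNReal.ofReal |f q.1 - f q.2| ∂(m.prod m) := by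
      rw [lintegral_prod _ hFf.aemeasurable]
      calc ∫⁻ u, h u * ENNReal.ofReal |f u - f t| ∂m
          ≤ ∫⁻ u, (h u * (η + S') +
              ∫⁻ v, h u * h' v * ENNReal.ofReal |f u - f v| ∂m) ∂m := by
            refine lintegral_mono fun u => ?_
            have h2 := hbound' (f u)
            have h3 : Measurable fun v => h' v * ENNReal.ofReal |f v - f u| :=
              hm'.mul (by fun_prop)
            have h4 : ∫⁻ v, h u * h' v * ENNReal.ofReal |f u - f v| ∂m =
                h u * ∫⁻ v, h' v * ENNReal.ofReal |f v - f u| ∂m := by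
              rw [← lintegral_const_mul _ h3]
              exact lintegral_congr fun v => by rw [mul_assoc, abs_sub_comm]
            rw [h4, ← mul_add, abs_sub_comm]
            gcongr
        _ = _ := by
            rw [lintegral_add_left (hm.mul_const _), lintegral_mul_const _ hm, h1, one_mul]
    refine (hbound (f t)).trans ((add_le_add_right (hj.trans (add_le_add_right htop _)) _).trans_eq
      ?_)
    rw [two_mul]
    abel
  refine hmain.trans (add_le_add_right ?_ _)
  have hbL : 0 ≤ b * (2 + L) := by positivity
  have hnn : ∀ {ρ : ℕ → ℝ}, (∀ j, 0 ≤ ρ j) → ∀ j,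
      0 ≤ b * (2 + L) * (R ^ (j + n) * chainRadius ρ l j) := fun hρ j =>
    mul_nonneg hbL (mul_nonneg (by positivity) (chainRadius_nonneg hρ l j))
  rw [hS, hS', ← ENNReal.ofReal_sum_of_nonneg fun j _ => hnn hr0 j,
    ← ENNReal.ofReal_sum_of_nonneg fun j _ => hnn hr0' j,
    ← ENNReal.ofReal_add (Finset.sum_nonneg fun j _ => hnn hr0 j)
      (Finset.sum_nonneg fun j _ => hnn hr0' j),
    ← ENNReal.ofReal_add (add_nonneg (Finset.sum_nonneg fun j _ => hnn hr0 j)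
      (Finset.sum_nonneg fun j _ => hnn hr0' j))
      (mul_nonneg hbL (mul_nonneg (by positivity) hD0))]
  refine ENNReal.ofReal_le_ofReal ?_
  have hXnn : ∀ j, 0 ≤ R ^ j * (min (r j) (dist s t) + min (r' j) (dist s t)) := fun j =>
    mul_nonneg (by positivity)
      (add_nonneg (le_min (hr0 j) dist_nonneg) (le_min (hr0' j) dist_nonneg))
  set X := ∑ j ∈ Finset.range (l + 1), R ^ j * (min (r j) (dist s t) + min (r' j) (dist s t))
    with hX
  have hX0 : 0 ≤ X := Finset.sum_nonneg fun j _ => hXnn j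
  set σ : ℕ → ℝ := fun j => R ^ j * (chainRadius r l j + chainRadius r' l j) with hσ
  have hσ0 : ∀ j, 0 ≤ σ j := fun j => mul_nonneg (by positivity)
    (add_nonneg (chainRadius_nonneg hr0 l j) (chainRadius_nonneg hr0' l j))
  have e1 : ∑ j ∈ Finset.Ico k l, σ j ≤ 8 * X :=
    (Finset.sum_le_sum_of_subset_of_nonneg (Finset.Ico_subset_Ico_right (by omega))
      fun j _ _ => hσ0 j).trans hsum
  have e2 : σ k ≤ 8 * X :=
    (Finset.single_le_sum (f := σ) (fun j _ => hσ0 j)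
      (Finset.mem_Ico.2 ⟨le_rfl, by omega⟩)).trans hsum
  have e3 : R ^ k * dist s t ≤ dist s t + R * X := by
    rcases k with _ | k
    · rw [pow_zero, one_mul]
      have : 0 ≤ R * X := by positivity
      linarith
    · have h4 := hsel k rfl
      have h5 : dist s t ≤ r k := by linarith
      have h6 : R ^ k * dist s t ≤ X := by
        refine le_trans ?_ (Finset.single_le_sum (fun j _ => hXnn j)
          (Finset.mem_range.2 (by omega : k < l + 1)))
        gcongr
        rw [min_eq_right h5]
        exact le_add_of_nonneg_right (le_min (hr0' k) dist_nonneg)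
      have h7 : 0 ≤ dist s t := dist_nonneg
      rw [pow_succ]
      nlinarith
  have e4 : ∑ j ∈ Finset.Ico k l, b * (2 + L) * (R ^ (j + n) * chainRadius r l j) +
      ∑ j ∈ Finset.Ico k l, b * (2 + L) * (R ^ (j + n) * chainRadius r' l j) +
      b * (2 + L) * (R ^ (k + n) * D) =
      b * (2 + L) * (R ^ n * (∑ j ∈ Finset.Ico k l, σ j + (R ^ k * dist s t + σ k))) := by
    rw [← Finset.sum_add_distrib, mul_add (R ^ n), mul_add (b * (2 + L)), Finset.mul_sum,
      Finset.mul_sum]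
    congr 1
    · refine Finset.sum_congr rfl fun j _ => ?_
      rw [hσ, pow_add]
      ring
    · rw [hσ, hD, pow_add]
      ring
  rw [e4]
  refine mul_le_mul_of_nonneg_left (mul_le_mul_of_nonneg_left ?_ (by positivity)) hbL
  linarith

end Join

section Minorizing

theorem ofReal_le_yinv {φ : ℝ → ℝ} (hφ : IsYoungFunction φ) {x : ℝ} {y : ℝ≥0∞}
    (hy : ENNReal.ofReal (φ x) < y) : ENNReal.ofReal x ≤ yinv φ y := by
  refine le_sInf ?_
  rintro _ ⟨r, hr0, rfl, hr⟩
  refine ENNReal.ofReal_le_ofReal ?_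
  by_contra! hlt
  exact absurd ((hy.trans_le hr).trans_le (ENNReal.ofReal_le_ofReal
    (hφ.1 hr0 (hr0.trans hlt.le : (0 : ℝ) ≤ x) hlt.le))) (lt_irrefl _)

theorem one_le_yinv {φ : ℝ → ℝ} (hφ : IsYoungFunction φ) (hφ1 : φ 1 = 1) {y : ℝ≥0∞}
    (hy : 1 ≤ y) : 1 ≤ yinv φ y := by
  refine le_sInf ?_
  rintro _ ⟨r, hr0, rfl, hr⟩
  have h := hy.trans hr
  rw [ENNReal.one_le_ofReal] at h ⊢
  by_contra! hlt
  have := hφ.le_self_of_le_one hφ1 hr0 hlt.le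
  linarith

theorem sum_range_succ_pow_le {R : ℝ} (hR : 2 ≤ R) (n : ℕ) :
    ∑ j ∈ Finset.range (n + 1), R ^ j ≤ 2 * R ^ n := by
  induction n with
  | zero => simp
  | succ n ih =>
    rw [Finset.sum_range_succ]
    have : 0 ≤ R ^ n := by positivity
    rw [pow_succ]
    nlinarith

variable {T : Type*} [MetricSpace T] [MeasurableSpace T]

theorem sum_indicator_le_yinv {φ : ℝ → ℝ} (hφ : IsYoungFunction φ) {R : ℝ} (hR : 2 ≤ R)
    (m : Measure T) (x : T) (ε : ℝ) (n : ℕ) :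
    ∑ j ∈ Finset.range n, (Set.Ioo 0 (massRadius m (ENNReal.ofReal (φ (R ^ j)))⁻¹ x)).indicator
      (fun _ => ENNReal.ofReal (R ^ j)) ε ≤ 2 * yinv φ (1 / m (Metric.closedBall x ε)) := by
  induction n with
  | zero => simp
  | succ n ih =>
    by_cases h : ε ∈ Set.Ioo 0 (massRadius m (ENNReal.ofReal (φ (R ^ n)))⁻¹ x)
    · have h1 : ENNReal.ofReal (R ^ n) ≤ yinv φ (1 / m (Metric.closedBall x ε)) := by
        refine ofReal_le_yinv hφ ?_
        rw [one_div, ← inv_inv (ENNReal.ofReal _)]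
        exact ENNReal.inv_lt_inv.2 (measure_closedBall_lt_of_lt_massRadius h.1.le h.2)
      calc _ ≤ ∑ j ∈ Finset.range (n + 1), ENNReal.ofReal (R ^ j) :=
            Finset.sum_le_sum fun j _ => by
              exact Set.indicator_apply_le' (fun _ => le_rfl) fun _ => zero_le
        _ = ENNReal.ofReal (∑ j ∈ Finset.range (n + 1), R ^ j) :=
            (ENNReal.ofReal_sum_of_nonneg fun j _ => by positivity).symm
        _ ≤ ENNReal.ofReal (2 * R ^ n) := ENNReal.ofReal_le_ofReal (sum_range_succ_pow_le hR n)
        _ = 2 * ENNReal.ofReal (R ^ n) := by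
            rw [ENNReal.ofReal_mul zero_le_two, ENNReal.ofReal_ofNat]
        _ ≤ 2 * yinv φ (1 / m (Metric.closedBall x ε)) := by gcongr
    · rw [Finset.sum_range_succ, Set.indicator_of_notMem h, add_zero]
      exact ih

theorem ofReal_sum_le_lintegral_yinv {φ : ℝ → ℝ} (hφ : IsYoungFunction φ) {R : ℝ} (hR : 2 ≤ R)
    (m : Measure T) (x : T) {d : ℝ} (hd : 0 ≤ d) (n : ℕ) :
    ENNReal.ofReal (∑ j ∈ Finset.range n,
        R ^ j * min (massRadius m (ENNReal.ofReal (φ (R ^ j)))⁻¹ x) d) ≤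
      2 * ∫⁻ ε in Set.Ioc 0 d, yinv φ (1 / m (Metric.closedBall x ε)) := by
  rw [ENNReal.ofReal_sum_of_nonneg fun j _ =>
    mul_nonneg (by positivity) (le_min (massRadius_nonneg _ _ _) hd)]
  calc _ ≤ ∑ j ∈ Finset.range n, ∫⁻ ε in Set.Ioc 0 d,
          (Set.Ioo 0 (massRadius m (ENNReal.ofReal (φ (R ^ j)))⁻¹ x)).indicator
            (fun _ => ENNReal.ofReal (R ^ j)) ε := by
        refine Finset.sum_le_sum fun j _ => ?_
        rw [lintegral_indicator_const measurableSet_Ioo,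
          Measure.restrict_apply measurableSet_Ioo, ENNReal.ofReal_mul (by positivity)]
        gcongr
        set r := massRadius m (ENNReal.ofReal (φ (R ^ j)))⁻¹ x
        calc ENNReal.ofReal (min r d) = volume (Set.Ioo 0 (min r d)) := by
              rw [Real.volume_Ioo, sub_zero]
          _ ≤ volume (Set.Ioo 0 r ∩ Set.Ioc 0 d) := measure_mono fun ε hε =>
              ⟨⟨hε.1, hε.2.trans_le (min_le_left _ _)⟩, hε.1, (hε.2.trans_le (min_le_right _ _)).le⟩
    _ = ∫⁻ ε in Set.Ioc 0 d, ∑ j ∈ Finset.range n,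
          (Set.Ioo 0 (massRadius m (ENNReal.ofReal (φ (R ^ j)))⁻¹ x)).indicator
            (fun _ => ENNReal.ofReal (R ^ j)) ε :=
        (lintegral_finsetSum _ fun j _ => measurable_const.indicator measurableSet_Ioo).symm
    _ ≤ ∫⁻ ε in Set.Ioc 0 d, 2 * yinv φ (1 / m (Metric.closedBall x ε)) :=
        lintegral_mono fun ε => sum_indicator_le_yinv hφ hR m x ε n
    _ = _ := lintegral_const_mul' _ _ ENNReal.ofNat_ne_top

theorem ofReal_dist_le_tauDist {φ : ℝ → ℝ} (hφ : IsYoungFunction φ) (hφ1 : φ 1 = 1)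
    (m : Measure T) [IsProbabilityMeasure m] (s t : T) :
    ENNReal.ofReal (dist s t) ≤ tauDist m φ s t := by
  refine le_max_of_le_left ?_
  calc ENNReal.ofReal (dist s t) = ∫⁻ _ in Set.Ioc (0 : ℝ) (dist s t), 1 := by simp
    _ ≤ _ := lintegral_mono fun ε => one_le_yinv hφ hφ1 (by
        rw [one_div, ENNReal.one_le_inv]
        exact prob_le_one)

variable [CompactSpace T] [BorelSpace T]

theorem abs_sub_le_mul_tauDist {φ ψ : ℝ → ℝ} (hφ : IsYoungFunction φ) (hφ1 : φ 1 = 1)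
    (hψ : IsYoungFunction ψ) (hψ1 : ψ 1 = 1) {R : ℝ} (hR : 16 ≤ R)
    (hlog : ∀ k, φ (R ^ (k + 1)) * φ (R ^ (k + 1)) ≤ φ (R ^ (k + 2)) * φ (R ^ k))
    (m : Measure T) [IsProbabilityMeasure m] {f : T → ℝ} (hf : Continuous f) {b : ℝ}
    (hb : 0 < b) (n : ℕ) {L : ℝ} (hL : 0 ≤ L)
    (henergy : ∀ k, ENNReal.ofReal (φ (R ^ (k + 1))) *
      ∫⁻ q, ballDensity m (ENNReal.ofReal (φ (R ^ k)))⁻¹ q * energyDensity ψ f b q ∂(m.prod m) ≤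
        ENNReal.ofReal (L * ψ (R ^ (k + n))))
    (henergy' : ∀ k, ENNReal.ofReal (φ (R ^ (k + 1))) *
      ∫⁻ q, joinDensity m (fun k => ENNReal.ofReal (φ (R ^ k))) k q *
        energyDensity ψ f b q ∂(m.prod m) ≤ ENNReal.ofReal (L * ψ (R ^ (k + n))))
    {s t : T} (hτ : tauDist m φ s t ≠ ⊤) :
    ENNReal.ofReal |f s - f t| ≤
      ENNReal.ofReal ((2 + L) * R ^ n * (1 + 4 * (R + 16))) * ENNReal.ofReal b *
        tauDist m φ s t := by
  rcases eq_or_ne s t with rfl | hst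
  · simp
  have hd : 0 < dist s t := dist_pos.2 hst
  set d := dist s t with hd_def
  set p : ℕ → ℝ≥0∞ := fun k => ENNReal.ofReal (φ (R ^ k)) with hp
  set τ : ℝ := (tauDist m φ s t).toReal with hτ_def
  have hτ0 : 0 ≤ τ := ENNReal.toReal_nonneg
  have hdτ : d ≤ τ := (ENNReal.ofReal_le_iff_le_toReal hτ).1 (ofReal_dist_le_tauDist hφ hφ1 m s t)
  have hsum : ∀ x, (∫⁻ ε in Set.Ioc (0 : ℝ) d, yinv φ (1 / m (Metric.closedBall x ε))) ≤
      tauDist m φ s t → ∀ n, ∑ j ∈ Finset.range n, R ^ j * min (massRadius m (p j)⁻¹ x) d ≤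
        2 * τ := by
    intro x hx n
    have h := (ofReal_sum_le_lintegral_yinv hφ (by linarith : 2 ≤ R) m x hd.le n).trans
      (mul_le_mul_right hx 2)
    have h2 := (ENNReal.ofReal_le_iff_le_toReal
      (ENNReal.mul_ne_top ENNReal.ofNat_ne_top hτ)).1 h
    rwa [ENNReal.toReal_mul, ENNReal.toReal_ofNat] at h2
  have hs := hsum s (le_max_left _ _)
  have ht := hsum t (le_max_right _ _)
  have hmin0 : ∀ x j, 0 ≤ R ^ j * min (massRadius m (p j)⁻¹ x) d := fun x j =>
    mul_nonneg (by positivity) (le_min (massRadius_nonneg _ _ _) hd.le)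
  have hone : ∀ k, 1 ≤ R ^ k := fun k => one_le_pow₀ (by linarith)
  have hφpow := hφ.one_le_apply_pow hφ1 (by linarith : 1 ≤ R)
  have hlim : Tendsto (fun l : ℕ => 2 * τ / R ^ l) atTop (nhds 0) :=
    tendsto_const_nhds.div_atTop (tendsto_pow_atTop_atTop_of_one_lt (by linarith))
  set A := (2 + L) * R ^ n * (1 + 4 * (R + 16)) with hA
  have hkey : ∀ η : ℝ, 0 < η → ENNReal.ofReal |f s - f t| ≤
      ENNReal.ofReal (A * b * τ) + 2 * ENNReal.ofReal η := by
    intro η hη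
    have hcont : ∀ x, ∃ δ > 0, ∀ u, dist x u < δ →
        ENNReal.ofReal |f x - f u| ≤ ENNReal.ofReal η := by
      intro x
      obtain ⟨δ, hδ, h⟩ := Metric.continuous_iff.1 hf x η hη
      refine ⟨δ, hδ, fun u hu => ENNReal.ofReal_le_ofReal ?_⟩
      rw [abs_sub_comm, ← Real.dist_eq]
      exact (h u (by rwa [dist_comm])).le
    obtain ⟨δ, hδ, hδs⟩ := hcont s
    obtain ⟨δ', hδ', hδt⟩ := hcont t
    obtain ⟨l, hl⟩ := (hlim.eventually_lt_const
      (lt_min hd (lt_min hδ hδ') : 0 < min d (min δ δ'))).exists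
    have hsmall : ∀ x, (∀ n, ∑ j ∈ Finset.range n, R ^ j * min (massRadius m (p j)⁻¹ x) d ≤
        2 * τ) → massRadius m (p l)⁻¹ x < min d (min δ δ') := by
      intro x hx
      have h1 : R ^ l * min (massRadius m (p l)⁻¹ x) d ≤ 2 * τ :=
        (Finset.single_le_sum (f := fun j => R ^ j * min (massRadius m (p j)⁻¹ x) d)
          (fun j _ => hmin0 x j) (Finset.self_mem_range_succ l)).trans (hx (l + 1))
      have h2 : min (massRadius m (p l)⁻¹ x) d < min d (min δ δ') :=
        ((le_div_iff₀' (zero_lt_one.trans_le (hone l))).2 h1).trans_lt hl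
      rcases min_lt_iff.1 h2 with h3 | h3
      · exact h3
      · exact absurd (h3.trans_le (min_le_left _ _)) (lt_irrefl _)
    have hls := hsmall s hs
    have hlt := hsmall t ht
    have hmain := abs_sub_le_of_energy m (p := p) (by simp [hp, hφ1])
      (fun k => by simpa [hp] using hφpow k) (fun k => ENNReal.ofReal_ne_top)
      (fun k => by
        simp only [hp]
        rw [← ENNReal.ofReal_mul (by linarith [hφpow (k + 1)]),
          ← ENNReal.ofReal_mul (by linarith [hφpow (k + 2)])]
        exact ENNReal.ofReal_le_ofReal (hlog k)) hψ hψ1 hf hb hR n hL henergy henergy' s t l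
      (hls.trans_le (min_le_left _ _)).le
      (fun u hu => hδs u (hu.trans_lt (hls.trans_le
        ((min_le_right _ _).trans (min_le_left _ _)))))
      (fun u hu => hδt u (hu.trans_lt (hlt.trans_le
        ((min_le_right _ _).trans (min_le_right _ _)))))
    rw [add_comm (2 * _)] at hmain
    refine hmain.trans (add_le_add_left (ENNReal.ofReal_le_ofReal ?_) _)
    have h3 := hs (l + 1)
    have h4 := ht (l + 1)
    simp only [mul_add, Finset.sum_add_distrib]
    have h5 : d + (R + 16) * (∑ j ∈ Finset.range (l + 1), R ^ j * min (massRadius m (p j)⁻¹ s) d +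
        ∑ j ∈ Finset.range (l + 1), R ^ j * min (massRadius m (p j)⁻¹ t) d) ≤
        (1 + 4 * (R + 16)) * τ := by nlinarith
    have h6 : 0 ≤ b * (2 + L) * R ^ n := by positivity
    have h7 := mul_le_mul_of_nonneg_left h5 h6
    calc _ = _ := ?_
      _ ≤ _ := h7
      _ = A * b * τ := by rw [hA]; ring
    ring
  rw [← ENNReal.ofReal_mul (by positivity), ← ENNReal.ofReal_toReal hτ,
    ← ENNReal.ofReal_mul (by positivity)]
  have hlim2 : Tendsto (fun η : ℝ => ENNReal.ofReal (A * b * τ) + 2 * ENNReal.ofReal η)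
      (nhdsWithin 0 (Set.Ioi 0)) (nhds (ENNReal.ofReal (A * b * τ) + 2 * ENNReal.ofReal 0)) := by
    refine Tendsto.mono_left ?_ nhdsWithin_le_nhds
    exact tendsto_const_nhds.add (ENNReal.Tendsto.const_mul
      ((ENNReal.continuous_ofReal).tendsto 0) (Or.inr ENNReal.ofNat_ne_top))
  rw [ENNReal.ofReal_zero, mul_zero, add_zero] at hlim2
  exact ge_of_tendsto hlim2 (eventually_nhdsWithin_of_forall hkey)

end Minorizing

section Regrouping

theorem monotone_shift_div_of_log_convex {q : ℕ → ℝ} (hq : ∀ k, 0 < q k)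
    (h : ∀ k, q (k + 1) * q (k + 1) ≤ q (k + 2) * q k) (i : ℕ) :
    Monotone fun j => q (j + i) / q j := by
  have hstep : Monotone fun j => q (j + 1) / q j := monotone_nat_of_le_succ fun k =>
    (div_le_div_iff₀ (hq _) (hq _)).2 (h k)
  induction i with
  | zero =>
    intro j k _
    simp [(hq _).ne']
  | succ i ih =>
    intro j k hjk
    have h1 : ∀ j, q (j + (i + 1)) / q j = q (j + i + 1) / q (j + i) * (q (j + i) / q j) := by
      intro j
      rw [div_mul_div_cancel₀ (hq _).ne', add_assoc]
    simp only [h1]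
    exact mul_le_mul (hstep (by omega)) (ih hjk) (div_pos (hq _) (hq _)).le
      (div_pos (hq _) (hq _)).le

theorem log_convex_regroup {φ : ℝ → ℝ} (hφ : IsYoungFunction φ) (hφ1 : φ 1 = 1)
    {R : ℝ} (hR : 1 ≤ R)
    (h : ∀ k : ℕ, 1 ≤ k → φ (R ^ k) / φ (R ^ (k + 1)) ≤ φ (R ^ (k - 1)) / φ (R ^ k)) (i k : ℕ) :
    φ ((R ^ i) ^ (k + 1)) * φ ((R ^ i) ^ (k + 1)) ≤
      φ ((R ^ i) ^ (k + 2)) * φ ((R ^ i) ^ k) := by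
  have hpos : ∀ k, 0 < φ (R ^ k) := fun k =>
    zero_lt_one.trans_le (hφ.one_le_apply_pow hφ1 hR k)
  have hmono := monotone_shift_div_of_log_convex hpos (fun k => by
    have := (div_le_div_iff₀ (hpos _) (hpos _)).1 (h (k + 1) (by omega))
    rw [Nat.add_sub_cancel] at this
    linarith) i (Nat.le_add_right (i * k) i)
  have h1 := (div_le_div_iff₀ (hpos _) (hpos _)).1 hmono
  rw [← pow_mul, ← pow_mul, ← pow_mul, mul_add_one, show i * (k + 2) = i * k + i + i by ring]
  exact h1

theorem summable_regroup {φ ψ : ℝ → ℝ} (hφ : IsYoungFunction φ) (hφ1 : φ 1 = 1)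
    (hψ : IsYoungFunction ψ) (hψ1 : ψ 1 = 1) {R : ℝ} (hR : 1 ≤ R) {n : ℕ}
    (h : Summable fun k : ℕ => φ (R ^ k) / ψ (R ^ (k + n))) {i : ℕ} (hi : 1 ≤ i) :
    Summable fun k : ℕ => φ ((R ^ i) ^ (k + 1)) / ψ ((R ^ i) ^ (k + (n + 1))) := by
  have hφp : ∀ k, 0 < φ (R ^ k) := fun k =>
    zero_lt_one.trans_le (hφ.one_le_apply_pow hφ1 hR k)
  have hψp : ∀ k, 0 < ψ (R ^ k) := fun k =>
    zero_lt_one.trans_le (hψ.one_le_apply_pow hψ1 hR k)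
  have hinj : Function.Injective fun k : ℕ => i * (k + 1) := fun a b hab => by
    have := Nat.eq_of_mul_eq_mul_left (by omega : 0 < i) hab
    omega
  refine Summable.of_nonneg_of_le (fun k => ?_) (fun k => ?_) (h.comp_injective hinj)
  · rw [← pow_mul, ← pow_mul]
    exact (div_pos (hφp _) (hψp _)).le
  · rw [← pow_mul, ← pow_mul]
    refine div_le_div_of_nonneg_left (hφp _).le (hψp _) ?_
    have hexp : i * (k + 1) + n ≤ i * (k + (n + 1)) := by nlinarith
    exact hψ.1 (pow_nonneg (by linarith) _ : (0 : ℝ) ≤ _)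
      (pow_nonneg (by linarith) _ : (0 : ℝ) ≤ _) (pow_le_pow_right₀ hR hexp)

end Regrouping

section Measures

/-- A separable space carries a probability measure charging every nonempty open set. -/
theorem exists_isProbabilityMeasure_isOpenPosMeasure (X : Type*) [TopologicalSpace X]
    [TopologicalSpace.SeparableSpace X] [Nonempty X] [MeasurableSpace X] [OpensMeasurableSpace X] :
    ∃ ρ : Measure X, IsProbabilityMeasure ρ ∧ ρ.IsOpenPosMeasure := by
  set x := TopologicalSpace.denseSeq X
  refine ⟨Measure.sum fun n => (2⁻¹ : ℝ≥0∞) ^ (n + 1) • Measure.dirac (x n), ⟨?_⟩, ⟨?_⟩⟩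
  · simpa [ENNReal.tsum_geometric_add_one] using
      ENNReal.inv_mul_cancel (a := 2) two_ne_zero ENNReal.ofNat_ne_top
  · intro U hU hne
    obtain ⟨n, hn⟩ := (TopologicalSpace.denseRange_denseSeq X).exists_mem_open hU hne
    have h2 : (0 : ℝ≥0∞) < 2⁻¹ := ENNReal.inv_pos.2 ENNReal.ofNat_ne_top
    refine ((ENNReal.pow_pos h2 (n + 1)).trans_le ?_).ne'
    calc (2⁻¹ : ℝ≥0∞) ^ (n + 1)
        = ((2⁻¹ : ℝ≥0∞) ^ (n + 1) • Measure.dirac (x n)) U := by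
          rw [Measure.smul_apply, Measure.dirac_apply_of_mem hn, smul_eq_mul, mul_one]
      _ ≤ _ := Measure.le_sum (fun n => (2⁻¹ : ℝ≥0∞) ^ (n + 1) • Measure.dirac (x n)) n U

/-- A probability measure of full support dominating a weighted family of finite measures. -/
theorem exists_isProbabilityMeasure_dominating {X : Type*} [TopologicalSpace X]
    [TopologicalSpace.SeparableSpace X] [Nonempty X] [MeasurableSpace X] [OpensMeasurableSpace X]
    {c : ℕ → ℝ} (hc : ∀ k, 0 ≤ c k) (hcs : Summable c) (μ : ℕ → Measure X)
    (hμ : ∀ k, μ k Set.univ ≤ 2) :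
    ∃ ν : Measure X, IsProbabilityMeasure ν ∧ ν.IsOpenPosMeasure ∧
      ∀ k, ENNReal.ofReal (c k) • μ k ≤ ENNReal.ofReal (1 + 2 * ∑' k, c k) • ν := by
  obtain ⟨ρ, hρ, hρo⟩ := exists_isProbabilityMeasure_isOpenPosMeasure X
  set N : Measure X := ρ + Measure.sum fun k => ENNReal.ofReal (c k) • μ k with hN
  have hρN : ρ ≤ N := Measure.le_add_right le_rfl
  have h1 : 1 ≤ N Set.univ := by simpa using hρN Set.univ
  have hM : N Set.univ ≤ ENNReal.ofReal (1 + 2 * ∑' k, c k) := by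
    rw [ENNReal.ofReal_add zero_le_one (mul_nonneg zero_le_two (tsum_nonneg hc)),
      ENNReal.ofReal_mul zero_le_two, ENNReal.ofReal_tsum_of_nonneg hc hcs, hN,
      Measure.add_apply, measure_univ, ENNReal.ofReal_one, Measure.sum_apply _ MeasurableSet.univ,
      ENNReal.ofReal_ofNat, ← ENNReal.tsum_mul_left]
    gcongr with k
    rw [Measure.smul_apply, smul_eq_mul, mul_comm]
    gcongr
    exact hμ k
  have h0 : N Set.univ ≠ 0 := (zero_lt_one.trans_le h1).ne'
  have ht : N Set.univ ≠ ⊤ := (hM.trans_lt ENNReal.ofReal_lt_top).ne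
  refine ⟨(N Set.univ)⁻¹ • N, ⟨?_⟩, ⟨fun U hU hne hU0 => ?_⟩, fun k => ?_⟩
  · rw [Measure.smul_apply, smul_eq_mul, ENNReal.inv_mul_cancel h0 ht]
  · rw [Measure.smul_apply, smul_eq_mul, mul_eq_zero, ENNReal.inv_eq_zero] at hU0
    exact hU.measure_ne_zero ρ hne (le_antisymm ((hρN U).trans_eq (hU0.resolve_left ht)) zero_le)
  · calc ENNReal.ofReal (c k) • μ k
        ≤ N := Measure.le_add_left
          (Measure.le_sum (fun k => ENNReal.ofReal (c k) • μ k) k)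
      _ = N Set.univ • (N Set.univ)⁻¹ • N := by
          rw [smul_smul, ENNReal.mul_inv_cancel h0 ht, one_smul]
      _ ≤ _ := by
          intro A
          simp only [Measure.smul_apply, smul_eq_mul]
          gcongr

theorem luxNorm_fdiv_ne_zero {T : Type*} [MetricSpace T] [CompactSpace T] [MeasurableSpace T]
    [OpensMeasurableSpace (T × T)] {ψ : ℝ → ℝ} (hψ : IsYoungFunction ψ) (hψ1 : ψ 1 = 1)
    (ν : Measure (T × T)) [IsFiniteMeasure ν] [ν.IsOpenPosMeasure] {f : T → ℝ}
    (hf : Continuous f) {s t : T} (hst : f s ≠ f t) :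
    luxNorm ν (fun x => max (ψ x - 1) 0) (fdiv f) ≠ 0 := by
  have hΔ : 0 < |f s - f t| := abs_pos.2 (sub_ne_zero.2 hst)
  set δ := |f s - f t| / 2 with hδ
  have hδ0 : 0 < δ := half_pos hΔ
  set U : Set (T × T) := {q | δ < |f q.1 - f q.2|} with hU
  have hUo : IsOpen U := isOpen_lt continuous_const (by fun_prop)
  have hUne : U.Nonempty := ⟨(s, t), half_lt_self hΔ⟩
  set C := Metric.diam (Set.univ : Set T) + 1 with hC
  have hC0 : 0 < C := by have := Metric.diam_nonneg (s := (Set.univ : Set T)); positivity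
  have hw : 0 < ν.real U :=
    ENNReal.toReal_pos (hUo.measure_ne_zero ν hUne) (measure_ne_top ν U)
  set w := ν.real U with hw_def
  have hfd : ∀ q ∈ U, δ / C ≤ |fdiv f q| := by
    intro q hq
    have hne : q.1 ≠ q.2 := by
      rintro h
      have : δ < |f q.1 - f q.2| := hq
      rw [h, sub_self, abs_zero] at this
      linarith
    have hdist : dist q.1 q.2 ≤ C := by
      have := Metric.dist_le_diam_of_mem (isCompact_univ (X := T)).isBounded
        (Set.mem_univ q.1) (Set.mem_univ q.2)
      linarith
    refine le_trans ?_ (le_abs_self _)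
    exact div_le_div₀ (abs_nonneg _) (le_of_lt hq) (dist_pos.2 hne) hdist
  have hb0 : 0 < δ / C / (1 + 1 / w) := by positivity
  refine ((ENNReal.ofReal_pos.2 hb0).trans_le (le_sInf ?_)).ne'
  rintro _ ⟨b, hb, rfl, hint⟩
  refine ENNReal.ofReal_le_ofReal ?_
  have h1 : ENNReal.ofReal (δ / C / b - 1) * ν U ≤ 1 := by
    rw [← setLIntegral_const]
    refine le_trans ?_ ((setLIntegral_le_lintegral U _).trans hint)
    refine setLIntegral_mono' hUo.measurableSet fun q hq => ENNReal.ofReal_le_ofReal ?_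
    have h2 : δ / C / b ≤ |fdiv f q| / b := by
      gcongr
      exact hfd q hq
    rcases le_total 1 (|fdiv f q| / b) with h3 | h3
    · have := hψ.self_le_of_one_le hψ1 h3
      exact le_max_of_le_left (by linarith)
    · exact le_max_of_le_right (by linarith)
  rw [← ENNReal.ofReal_toReal (measure_ne_top ν U),
    ← ENNReal.ofReal_mul' ENNReal.toReal_nonneg, ENNReal.ofReal_le_one] at h1
  have h2 : (δ / C / b - 1) * w ≤ 1 := h1
  have h3 : δ / C / b ≤ 1 + 1 / w := by
    have := (le_div_iff₀ hw).2 h2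
    linarith
  rw [div_le_iff₀ hb] at h3
  rw [div_le_iff₀ (by positivity)]
  linarith

end Measures

section Main

variable {T : Type*} [MetricSpace T] [CompactSpace T] [MeasurableSpace T] [BorelSpace T]

theorem exists_dominating_energies {p : ℕ → ℝ≥0∞} (hp1 : ∀ k, 1 ≤ p k) (hpt : ∀ k, p k ≠ ⊤)
    {c : ℕ → ℝ} (hc : ∀ k, 0 ≤ c k) (hcs : Summable c) (m : Measure T) [IsProbabilityMeasure m] :
    ∃ ν : Measure (T × T), IsProbabilityMeasure ν ∧ ν.IsOpenPosMeasure ∧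
      ∀ G : T × T → ℝ≥0∞, Measurable G → ∫⁻ q, G q ∂ν ≤ 1 → ∀ k,
        ENNReal.ofReal (c k) * ∫⁻ q, (ballDensity m (p k)⁻¹ q + joinDensity m p k q) * G q
          ∂(m.prod m) ≤ ENNReal.ofReal (1 + 2 * ∑' k, c k) := by
  have : Nonempty T := m.nonempty_of_neZero
  have hc1 : ∀ k, (p k)⁻¹ ≤ 1 := fun k => ENNReal.inv_le_one.2 (hp1 k)
  have hball : ∀ k, Measurable fun q => ballDensity m (p k)⁻¹ q :=
    fun k => measurable_ballDensity m (hc1 k)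
  have hw : ∀ k, Measurable fun q => ballDensity m (p k)⁻¹ q + joinDensity m p k q :=
    fun k => (hball k).add (measurable_joinDensity m hp1 k)
  obtain ⟨ν, hν, hνo, hdom⟩ := exists_isProbabilityMeasure_dominating hc hcs
    (fun k => (m.prod m).withDensity fun q => ballDensity m (p k)⁻¹ q + joinDensity m p k q)
    (fun k => by
      have h1 : ∫⁻ q, ballDensity m (p k)⁻¹ q ∂(m.prod m) = 1 := by
        rw [lintegral_prod _ (hball k).aemeasurable]
        simp [lintegral_ballDensity m (hc1 k) (ENNReal.inv_ne_zero.2 (hpt k))]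
      rw [withDensity_apply _ MeasurableSet.univ, Measure.restrict_univ,
        lintegral_add_left (hball k), h1, ← one_add_one_eq_two]
      gcongr
      exact lintegral_joinDensity_le m hp1 k)
  refine ⟨ν, hν, hνo, fun G hG hint k => ?_⟩
  have h := lintegral_mono' (hdom k) (le_refl G)
  rw [lintegral_smul_measure, lintegral_smul_measure,
    lintegral_withDensity_eq_lintegral_mul _ (hw k) hG] at h
  exact h.trans (mul_le_of_le_one_right' hint)

theorem exists_measure_fdiv_bound {φ ψ : ℝ → ℝ} (hφ : IsYoungFunction φ) (hφ1 : φ 1 = 1)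
    (hψ : IsYoungFunction ψ) (hψ1 : ψ 1 = 1) {R : ℝ} (hR : 16 ≤ R)
    (hlog : ∀ k, φ (R ^ (k + 1)) * φ (R ^ (k + 1)) ≤ φ (R ^ (k + 2)) * φ (R ^ k)) {n : ℕ}
    (hsum : Summable fun k : ℕ => φ (R ^ (k + 1)) / ψ (R ^ (k + n)))
    (m : Measure T) [IsProbabilityMeasure m] :
    ∃ ν : Measure (T × T), IsProbabilityMeasure ν ∧ ∀ f : T → ℝ, Continuous f → ∀ s t : T,
      ENNReal.ofReal |f s - f t| ≤
        ENNReal.ofReal ((2 + (1 + 2 * ∑' k : ℕ, φ (R ^ (k + 1)) / ψ (R ^ (k + n)))) * R ^ n *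
          (1 + 4 * (R + 16))) * luxNorm ν (fun x => max (ψ x - 1) 0) (fdiv f) *
            tauDist m φ s t := by
  have hR1 : 1 ≤ R := by linarith
  have hφp := hφ.one_le_apply_pow hφ1 hR1
  have hψp := hψ.one_le_apply_pow hψ1 hR1
  have hc : ∀ k, 0 ≤ φ (R ^ (k + 1)) / ψ (R ^ (k + n)) := fun k =>
    div_nonneg (zero_le_one.trans (hφp _)) (zero_le_one.trans (hψp _))
  set L := 1 + 2 * ∑' k : ℕ, φ (R ^ (k + 1)) / ψ (R ^ (k + n)) with hL
  have hL0 : 0 ≤ L := by have := tsum_nonneg (L := .unconditional ℕ) hc; positivity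
  obtain ⟨ν, hν, hνo, hdom⟩ := exists_dominating_energies
    (p := fun k => ENNReal.ofReal (φ (R ^ k))) (fun k => ENNReal.one_le_ofReal.2 (hφp k))
    (fun k => ENNReal.ofReal_ne_top) hc hsum m
  refine ⟨ν, hν, fun f hf s t => ?_⟩
  set A := (2 + L) * R ^ n * (1 + 4 * (R + 16)) with hA
  have hA0 : 0 < A := by positivity
  rcases eq_or_ne (f s) (f t) with hst | hst
  · simp [hst]
  have hτ0 : tauDist m φ s t ≠ 0 := by
    refine ((ENNReal.ofReal_pos.2 (dist_pos.2 ?_)).trans_le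
      (ofReal_dist_le_tauDist hφ hφ1 m s t)).ne'
    rintro rfl
    exact hst rfl
  by_cases hτ : tauDist m φ s t = ⊤
  · rw [hτ, ENNReal.mul_top (mul_ne_zero (ENNReal.ofReal_pos.2 hA0).ne'
      (luxNorm_fdiv_ne_zero hψ hψ1 ν hf hst))]
    exact le_top
  have hfac0 : ENNReal.ofReal A * tauDist m φ s t ≠ 0 :=
    mul_ne_zero (ENNReal.ofReal_pos.2 hA0).ne' hτ0
  have hfact : ENNReal.ofReal A * tauDist m φ s t ≠ ⊤ := ENNReal.mul_ne_top ENNReal.ofReal_ne_top hτ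
  rw [mul_assoc, mul_left_comm, ← ENNReal.div_le_iff hfac0 hfact]
  refine le_sInf ?_
  rintro _ ⟨b, hb, rfl, hint⟩
  rw [ENNReal.div_le_iff hfac0 hfact, mul_left_comm, ← mul_assoc]
  have hG := measurable_energyDensity hψ hf hb
  have hE := hdom (energyDensity ψ f b) hG hint
  have henergy : ∀ w : ℕ → T × T → ℝ≥0∞, (∀ k q, w k q ≤
      ballDensity m (ENNReal.ofReal (φ (R ^ k)))⁻¹ q +
        joinDensity m (fun k => ENNReal.ofReal (φ (R ^ k))) k q) →
      ∀ k, ENNReal.ofReal (φ (R ^ (k + 1))) *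
        ∫⁻ q, w k q * energyDensity ψ f b q ∂(m.prod m) ≤
          ENNReal.ofReal (L * ψ (R ^ (k + n))) := by
    intro w hw k
    have hψ0 : 0 < ψ (R ^ (k + n)) := zero_lt_one.trans_le (hψp _)
    calc _ ≤ ENNReal.ofReal (φ (R ^ (k + 1))) *
          ∫⁻ q, (ballDensity m (ENNReal.ofReal (φ (R ^ k)))⁻¹ q +
            joinDensity m (fun k => ENNReal.ofReal (φ (R ^ k))) k q) *
              energyDensity ψ f b q ∂(m.prod m) := by
          gcongr with q
          exact hw k q
      _ = ENNReal.ofReal (φ (R ^ (k + 1)) / ψ (R ^ (k + n))) *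
          (∫⁻ q, (ballDensity m (ENNReal.ofReal (φ (R ^ k)))⁻¹ q +
            joinDensity m (fun k => ENNReal.ofReal (φ (R ^ k))) k q) *
              energyDensity ψ f b q ∂(m.prod m)) * ENNReal.ofReal (ψ (R ^ (k + n))) := by
          rw [mul_right_comm, ← ENNReal.ofReal_mul (hc k), div_mul_cancel₀ _ hψ0.ne']
      _ ≤ ENNReal.ofReal L * ENNReal.ofReal (ψ (R ^ (k + n))) := by
          gcongr
          exact hE k
      _ = _ := (ENNReal.ofReal_mul hL0).symm
  exact abs_sub_le_mul_tauDist hφ hφ1 hψ hψ1 hR hlog m hf hb n hL0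
    (henergy (fun k => ballDensity m (ENNReal.ofReal (φ (R ^ k)))⁻¹) fun _ _ => le_self_add)
    (henergy (fun k => joinDensity m (fun k => ENNReal.ofReal (φ (R ^ k))) k)
      fun _ _ => le_add_self) hτ

end Main

/-- Theorem 1, inequality (1.4) of the paper. -/
theorem statement0 (φ ψ : ℝ → ℝ) (hφ : IsYoungFunction φ) (hψ : IsYoungFunction ψ)
    (hφ1 : φ 1 = 1) (hψ1 : ψ 1 = 1) (R : ℝ) (hR : 1 < R) (n₀ : ℕ) (hn₀ : 1 ≤ n₀)
    (hmiau : ∀ k : ℕ, 1 ≤ k → φ (R ^ k) / φ (R ^ (k + 1)) ≤ φ (R ^ (k - 1)) / φ (R ^ k))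
    (hpap : Summable fun k : ℕ => φ (R ^ k) / ψ (R ^ (k + n₀))) :
    ∃ K : ℝ, 0 < K ∧
      ∀ (T : Type) [MetricSpace T] [CompactSpace T] [MeasurableSpace T] [BorelSpace T]
        (m : Measure T), IsProbabilityMeasure m →
          ∃ ν : Measure (T × T), IsProbabilityMeasure ν ∧
            ∀ f : T → ℝ, Continuous f → ∀ s t : T,
              ENNReal.ofReal |f s - f t| ≤
                ENNReal.ofReal K *
                  luxNorm ν (fun x => max (ψ x - 1) 0) (fdiv f) *
                    tauDist m φ s t := by
  obtain ⟨i, hi⟩ := pow_unbounded_of_one_lt 16 hR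
  have hi1 : 1 ≤ i := by
    by_contra h
    rw [Nat.lt_one_iff.1 (not_le.1 h), pow_zero] at hi
    linarith
  have hsum := summable_regroup hφ hφ1 hψ hψ1 hR.le hpap hi1
  have hlog := log_convex_regroup hφ hφ1 hR.le hmiau i
  have hc : ∀ k : ℕ, 0 ≤ φ ((R ^ i) ^ (k + 1)) / ψ ((R ^ i) ^ (k + (n₀ + 1))) := fun k =>
    div_nonneg
      (zero_le_one.trans (hφ.one_le_apply_pow hφ1 (by linarith) _))
      (zero_le_one.trans (hψ.one_le_apply_pow hψ1 (by linarith) _))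
  refine ⟨_, ?_, fun T _ _ _ _ m _ =>
    exists_measure_fdiv_bound hφ hφ1 hψ hψ1 hi.le hlog hsum m⟩
  have := tsum_nonneg (L := .unconditional ℕ) hc
  positivity
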